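/- arXiv:1112.6137 — 2 statements merged into one kernel-verified Lean document; each statement's English description precedes it below -/
import Mathlib

section
/- Let p and q be polynomials over ℂ with q ≠ 0, let S be a finite subset of ℂ, and let h : ℂ → ℂ be holomorphic on the complement of S (i.e. h is complex-differentiable at every point of ℂ \ S). Suppose that for every z ∉ S one has q(z) ≠ 0 and p(z) = exp(h(z)) · q(z). Then the rational function p/q is constant: there exists c ∈ ℂ such that p = c · q as polynomials. -/
/-- logarithmic derivative of a polynomial with a factor split off -/
theorem aux_logDeriv (a z : ℂ) (m : ℕ) (u : Polynomial ℂ) (hz : z - a ≠ 0) (hu : u.eval z ≠ 0) :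
    logDeriv (fun w => ((Polynomial.X - Polynomial.C a) ^ m * u).eval w) z
      = m * (z - a)⁻¹ + u.derivative.eval z / u.eval z := by
  have h1 : (fun w => ((Polynomial.X - Polynomial.C a) ^ m * u).eval w)
      = fun w => (w - a) ^ m * u.eval w := by
    funext w; simp
  rw [h1, logDeriv_mul (f := fun w : ℂ => (w - a) ^ m) (g := fun w => u.eval w) z
    (pow_ne_zero _ hz) hu (by fun_prop) u.differentiableAt]
  have h2 : logDeriv (fun w : ℂ => (w - a) ^ m) z = m * (z - a)⁻¹ := by
    rw [logDeriv_fun_pow (by fun_prop)]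
    simp [logDeriv_apply]
  have h3 : logDeriv (fun w : ℂ => u.eval w) z = u.derivative.eval z / u.eval z := by
    simp [logDeriv_apply]
  rw [h2, h3]

theorem aux_mult (p q : Polynomial ℂ) (hp : p ≠ 0) (hq : q ≠ 0) (S : Finset ℂ) (h : ℂ → ℂ)
    (hhol : DifferentiableOn ℂ h ((S : Set ℂ))ᶜ)
    (heq : ∀ z : ℂ, z ∉ S → q.eval z ≠ 0 ∧
      p.eval z = Complex.exp (h z) * q.eval z) (a : ℂ) :
    p.rootMultiplicity a = q.rootMultiplicity a := by
  obtain ⟨u, hpu, hu⟩ := Polynomial.exists_eq_pow_rootMultiplicity_mul_and_not_dvd p hp a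
  obtain ⟨v, hqv, hv⟩ := Polynomial.exists_eq_pow_rootMultiplicity_mul_and_not_dvd q hq a
  rw [Polynomial.dvd_iff_isRoot, Polynomial.IsRoot.def] at hu hv
  set m := p.rootMultiplicity a
  set n := q.rootMultiplicity a
  have e1 : ∀ᶠ z in nhds a, u.eval z ≠ 0 := u.continuousAt.eventually_ne hu
  have e2 : ∀ᶠ z in nhds a, v.eval z ≠ 0 := v.continuousAt.eventually_ne hv
  have e3 : ∀ᶠ z in nhds a, z ∉ S.erase a := by
    have := (S.erase a).finite_toSet.isClosed.isOpen_compl.mem_nhds (x := a) (by simp)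
    filter_upwards [this] with z hz using fun hh => hz (Finset.mem_coe.2 hh)
  obtain ⟨R, hR, hball⟩ := Metric.nhds_basis_closedBall.eventually_iff.1 (e1.and (e2.and e3))
  have hS : IsOpen ((S : Set ℂ))ᶜ := S.finite_toSet.isClosed.isOpen_compl
  let g : ℂ → ℂ := fun z => u.derivative.eval z / u.eval z - v.derivative.eval z / v.eval z
  have hg : DifferentiableOn ℂ g (Metric.closedBall a R) := by
    intro z hz
    obtain ⟨h1, h2, -⟩ := hball hz
    exact ((u.derivative.differentiableAt.div u.differentiableAt h1).sub
      (v.derivative.differentiableAt.div v.differentiableAt h2)).differentiableWithinAt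
  have hgi : (∮ z in C(a, R), g z) = 0 :=
    Complex.circleIntegral_eq_zero_of_differentiable_on_off_countable hR.le
      Set.countable_empty hg.continuousOn (fun z hz =>
        hg.differentiableAt (Filter.mem_of_superset
          (Metric.isOpen_ball.mem_nhds hz.1) Metric.ball_subset_closedBall))
  have hd : ∀ z ∈ Metric.sphere a R,
      HasDerivAt h (((m : ℂ) - n) * (z - a)⁻¹ + g z) z := by
    intro z hz
    obtain ⟨h1, h2, h3⟩ := hball (Metric.sphere_subset_closedBall hz)
    have hza : z ≠ a := by
      rintro rfl
      simp at hz
      exact hR.ne hz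
    have hzS : z ∉ S := fun hh => h3 (Finset.mem_erase.2 ⟨hza, hh⟩)
    have hdz : DifferentiableAt ℂ h z := hhol.differentiableAt (hS.mem_nhds (by simpa using hzS))
    have key : logDeriv (fun w => p.eval w) z = deriv h z + logDeriv (fun w => q.eval w) z := by
      have : (fun w => p.eval w) =ᶠ[nhds z] fun w => Complex.exp (h w) * q.eval w := by
        filter_upwards [hS.mem_nhds (show z ∈ ((S : Set ℂ))ᶜ by simpa using hzS)] with w hw
        exact (heq w (by simpa using hw)).2
      have e : logDeriv (fun w => p.eval w) z
          = logDeriv (fun w => Complex.exp (h w) * q.eval w) z := by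
        rw [logDeriv_apply, logDeriv_apply, this.deriv_eq, this.eq_of_nhds]
      rw [e, logDeriv_mul (f := fun w => Complex.exp (h w)) (g := fun w => q.eval w) z
        (Complex.exp_ne_zero _) (heq z hzS).1 hdz.cexp q.differentiableAt]
      congr 1
      rw [logDeriv_apply, hdz.hasDerivAt.cexp.deriv]
      field_simp [Complex.exp_ne_zero]
    rw [hpu, hqv, aux_logDeriv a z m u (sub_ne_zero.2 hza) h1,
      aux_logDeriv a z n v (sub_ne_zero.2 hza) h2] at key
    have e : ((m : ℂ) - n) * (z - a)⁻¹ + g z = deriv h z := by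
      simp only [g]
      linear_combination key
    rw [e]
    exact hdz.hasDerivAt
  have h0 := circleIntegral.integral_eq_zero_of_hasDerivWithinAt hR.le
    (fun z hz => (hd z hz).hasDerivWithinAt)
  have hci : CircleIntegrable (fun z : ℂ => ((m : ℂ) - n) * (z - a)⁻¹) a R := by
    apply ContinuousOn.circleIntegrable hR.le
    intro z hz
    have hza : z - a ≠ 0 := by
      rw [sub_ne_zero]
      rintro rfl
      simp at hz
      exact hR.ne hz
    have : ContinuousAt (fun z : ℂ => ((m : ℂ) - n) * (z - a)⁻¹) z := by
      fun_prop (disch := assumption)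
    exact this.continuousWithinAt
  rw [circleIntegral.integral_add hci
    ((hg.continuousOn.mono Metric.sphere_subset_closedBall).circleIntegrable hR.le), hgi,
    circleIntegral.integral_const_mul, circleIntegral.integral_sub_center_inv a hR.ne', add_zero,
    mul_eq_zero] at h0
  have := h0.resolve_right Complex.two_pi_I_ne_zero
  exact_mod_cast sub_eq_zero.1 this

/-- If `p/q` is a rational function which, away from a finite set `S`,
equals `exp ∘ h` for a function `h` holomorphic off `S`, then `p/q` is
constant, i.e. `p = c * q` for some constant `c`. -/
theorem rational_exp_of_holomorphic_is_constant
    (p q : Polynomial ℂ) (hq : q ≠ 0) (S : Finset ℂ) (h : ℂ → ℂ)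
    (hhol : DifferentiableOn ℂ h ((S : Set ℂ))ᶜ)
    (heq : ∀ z : ℂ, z ∉ S → q.eval z ≠ 0 ∧
      p.eval z = Complex.exp (h z) * q.eval z) :
    ∃ c : ℂ, p = Polynomial.C c * q := by
  have hp : p ≠ 0 := by
    rintro rfl
    obtain ⟨z, hz⟩ := Infinite.exists_notMem_finset S
    have := heq z hz
    simp [this.1, Complex.exp_ne_zero] at this
  have hr : p.roots = q.roots := by
    ext a
    rw [Polynomial.count_roots, Polynomial.count_roots]
    exact aux_mult p q hp hq S h hhol heq a
  have e1 := (IsAlgClosed.splits p).eq_prod_roots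
  have e2 := (IsAlgClosed.splits q).eq_prod_roots
  refine ⟨p.leadingCoeff / q.leadingCoeff, ?_⟩
  have hl : q.leadingCoeff ≠ 0 := Polynomial.leadingCoeff_ne_zero.2 hq
  generalize p.leadingCoeff = x at *
  generalize q.leadingCoeff = y at *
  rw [hr] at e1
  generalize (Multiset.map (fun a => Polynomial.X - Polynomial.C a) q.roots).prod = P at *
  rw [e1, e2, ← mul_assoc, ← Polynomial.C_mul, div_mul_cancel₀ _ hl]
end

section
/- Let D, B ∈ ℂ and let c : ℂ × ℂ → ℂ be holomorphic on the torus {(λ, μ) ∈ ℂ × ℂ : λ ≠ 0 and μ ≠ 0}. Suppose that D · λ · μ = −B · exp(c(λ, μ)) for all λ ≠ 0 and μ ≠ 0. Then D = 0 and B = 0. -/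
/-- If `D * λ * μ = -B * exp (c (λ, μ))` holds identically on the
two-dimensional torus `ℂ* × ℂ*`, with `c` holomorphic there, then
`D = 0` and `B = 0`. -/
theorem vanishing_from_torus_identity (D B : ℂ) (c : ℂ × ℂ → ℂ)
    (hc : DifferentiableOn ℂ c {p : ℂ × ℂ | p.1 ≠ 0 ∧ p.2 ≠ 0})
    (h : ∀ l m : ℂ, l ≠ 0 → m ≠ 0 →
      D * l * m = -B * Complex.exp (c (l, m))) :
    D = 0 ∧ B = 0 := by
  have hD : D = 0 := by
    by_contra hD
    have hopen : IsOpen {p : ℂ × ℂ | p.1 ≠ 0 ∧ p.2 ≠ 0} :=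
      (isOpen_ne_fun continuous_fst continuous_const).inter
        (isOpen_ne_fun continuous_snd continuous_const)
    have hder : ∀ z : ℂ, z ≠ 0 → HasDerivAt (fun w : ℂ => c (w, 1)) (z - 0)⁻¹ z := by
      intro z hz
      have hcz : DifferentiableAt ℂ c (z, 1) :=
        hc.differentiableAt (hopen.mem_nhds ⟨hz, one_ne_zero⟩)
      have hf : DifferentiableAt ℂ (fun w : ℂ => c (w, 1)) z :=
        DifferentiableAt.comp (f := fun w : ℂ => (w, (1 : ℂ))) z hcz (by fun_prop)
      have h1 := (hf.hasDerivAt.cexp).const_mul (-B)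
      have h2 : HasDerivAt (fun w : ℂ => D * w) (D * 1) z := (hasDerivAt_id z).const_mul D
      have h3 : (fun w : ℂ => D * w) =ᶠ[nhds z] fun w => -B * Complex.exp (c (w, 1)) := by
        filter_upwards [isOpen_ne.mem_nhds hz] with w hw
        simpa using h w 1 hw one_ne_zero
      have h4 := h2.unique (h1.congr_of_eventuallyEq h3)
      rw [← mul_assoc, ← h z 1 hz one_ne_zero, mul_one, mul_one, mul_assoc] at h4
      have h5 : z * deriv (fun w : ℂ => c (w, 1)) z = 1 := by
        apply mul_left_cancel₀ hD
        rw [← h4, mul_one]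
      have h6 := hf.hasDerivAt
      rw [eq_inv_of_mul_eq_one_right h5] at h6
      rwa [sub_zero]
    have hi := circleIntegral.integral_eq_zero_of_hasDerivWithinAt (c := (0 : ℂ)) (R := 1)
      (f := fun w : ℂ => c (w, 1)) (f' := fun z => (z - 0)⁻¹) zero_le_one (by
        intro z hz
        refine (hder z ?_).hasDerivWithinAt
        rintro rfl
        simp at hz)
    rw [circleIntegral.integral_sub_inv_of_mem_ball (by simp)] at hi
    exact Complex.two_pi_I_ne_zero hi
  refine ⟨hD, ?_⟩
  have h1 := h 1 1 one_ne_zero one_ne_zero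
  simpa [hD, Complex.exp_ne_zero] using h1
end
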